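/- (½-Hölder continuity of spectra of quasi-periodic Jacobi matrices) Let c, v ∈ C¹(ℝ/ℤ; ℂ) with v real-valued, and for α, θ ∈ ℝ let H_{α,θ} be the Jacobi matrix (H_{α,θ}u)_n = c(θ+nα)u_{n+1} + conj(c(θ+(n-1)α))u_{n-1} + v(θ+nα)u_n on ℓ²(ℤ), and Σ_α = ∪_θ σ(H_{α,θ}). Then there exist constants C̃(c,v), C(c,v) > 0 such that: if λ ∈ Σ_α and |α - α'| < C̃, then there exists λ' ∈ Σ_{α'} with |λ - λ'| ≤ C|α - α'|^{1/2}. -/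

import Mathlib

/-- A real point of the spectrum of a self-adjoint operator is an approximate eigenvalue. -/
theorem exists_norm_apply_sub_smul_le {E : Type*} [NormedAddCommGroup E] [InnerProductSpace ℂ E]
    [CompleteSpace E] {T : E →L[ℂ] E} (hT : IsSelfAdjoint T) {l : ℝ}
    (hl : (l : ℂ) ∈ spectrum ℂ T) {ε : ℝ} (hε : 0 < ε) :
    ∃ x : E, x ≠ 0 ∧ ‖T x - (l : ℂ) • x‖ ≤ ε * ‖x‖ := by
  by_contra! h
  set S : E →L[ℂ] E := T - algebraMap ℂ (E →L[ℂ] E) l with hS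
  have hSx : ∀ x, S x = T x - (l : ℂ) • x := fun x => by
    simp [hS, Algebra.algebraMap_eq_smul_one]
  have hSsa : IsSelfAdjoint S := hT.sub (IsSelfAdjoint.algebraMap _ (Complex.conj_ofReal l))
  have hsq : IsUnit (S * S) := by
    refine ContinuousLinearMap.isUnit_of_forall_le_norm_inner_map (S * S)
      (c := ⟨ε ^ 2, by positivity⟩) (by change 0 < ε ^ 2; positivity) fun x => ?_
    have h1 : inner ℂ ((S * S) x) x = inner ℂ (S x) (S x) :=
      (ContinuousLinearMap.isSelfAdjoint_iff_isSymmetric.mp hSsa) (S x) x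
    rw [h1, inner_self_eq_norm_sq_to_K]
    simp only [norm_pow, Complex.coe_algebraMap, Complex.norm_real, norm_norm]
    by_cases hx : x = 0
    · simp [hx]
    · have := (h x hx).le
      rw [← hSx] at this
      calc ‖x‖ ^ 2 * ε ^ 2 = (ε * ‖x‖) ^ 2 := by ring
        _ ≤ _ := by gcongr
  have hu : IsUnit S := ((Commute.refl S).isUnit_mul_iff.mp hsq).1
  refine hl (spectrum.mem_resolventSet_iff.mpr ?_)
  simpa [hS, neg_sub] using hu.neg

/-- An approximate eigenvalue of a self-adjoint operator is close to its spectrum. -/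
theorem exists_mem_spectrum_abs_sub_le {E : Type*} [NormedAddCommGroup E] [InnerProductSpace ℂ E]
    [CompleteSpace E] {T : E →L[ℂ] E} (hT : IsSelfAdjoint T) {l r : ℝ} (hr : 0 ≤ r)
    {x : E} (hx : x ≠ 0) (h : ‖T x - (l : ℂ) • x‖ ≤ r * ‖x‖) :
    ∃ l' : ℝ, (l' : ℂ) ∈ spectrum ℂ T ∧ |l - l'| ≤ r := by
  by_cases hl : (l : ℂ) ∈ spectrum ℂ T
  · exact ⟨l, hl, by simpa using hr⟩
  have : Nontrivial E := ⟨⟨x, 0, hx⟩⟩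
  have hsa : IsSelfAdjoint (T - algebraMap ℂ (E →L[ℂ] E) l) :=
    hT.sub (IsSelfAdjoint.algebraMap _ (Complex.conj_ofReal l))
  have hunit : IsUnit (T - algebraMap ℂ (E →L[ℂ] E) l) := by
    have := (spectrum.notMem_iff.mp hl).neg
    rwa [neg_sub] at this
  obtain ⟨S, hS⟩ := hunit
  have hSx : (S : E →L[ℂ] E) x = T x - (l : ℂ) • x := by
    simp [hS, Algebra.algebraMap_eq_smul_one]
  have hinv : IsSelfAdjoint ((S⁻¹ : (E →L[ℂ] E)ˣ) : E →L[ℂ] E) := by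
    have h1 : IsSelfAdjoint S := Units.ext (by rw [Units.coe_star, hS]; exact hsa)
    have h2 : IsSelfAdjoint S⁻¹ := h1.inv
    have := congrArg (Units.val) h2.star_eq
    rwa [Units.coe_star] at this
  obtain ⟨z, hz, hzn⟩ := spectrum.exists_nnnorm_eq_spectralRadius
    ((S⁻¹ : (E →L[ℂ] E)ˣ) : E →L[ℂ] E)
  rw [hinv.spectralRadius_eq_nnnorm] at hzn
  have hzn' : ‖z‖ = ‖((S⁻¹ : (E →L[ℂ] E)ˣ) : E →L[ℂ] E)‖ :=
    congrArg NNReal.toReal (ENNReal.coe_injective hzn)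
  have hz2 : z⁻¹ ∈ spectrum ℂ (S : E →L[ℂ] E) := by
    rw [← spectrum.map_inv, Set.mem_inv] at hz
    exact hz
  have hzT : z⁻¹ + l ∈ spectrum ℂ T := by
    rw [hS, ← spectrum.sub_singleton_eq] at hz2
    obtain ⟨y, hy, w, rfl, hyw⟩ := hz2
    have : z⁻¹ + l = y := by rw [← hyw]; simp
    rwa [this]
  have hre := hT.mem_spectrum_eq_re hzT
  refine ⟨(z⁻¹ + l).re, hre ▸ hzT, ?_⟩
  have hxn : ‖x‖ ≤ ‖z‖ * (r * ‖x‖) := by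
    have : x = ((S⁻¹ : (E →L[ℂ] E)ˣ) : E →L[ℂ] E) ((S : E →L[ℂ] E) x) := by
      rw [← mul_apply_eq_comp, Units.inv_mul, one_apply_eq_self]
    calc ‖x‖ = ‖((S⁻¹ : (E →L[ℂ] E)ˣ) : E →L[ℂ] E) ((S : E →L[ℂ] E) x)‖ := by rw [← this]
      _ ≤ ‖z‖ * ‖(S : E →L[ℂ] E) x‖ := by
        rw [hzn']; exact ContinuousLinearMap.le_opNorm _ _
      _ ≤ _ := by rw [hSx]; gcongr
  have hx0 : 0 < ‖x‖ := norm_pos_iff.mpr hx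
  have hzr : 1 ≤ ‖z‖ * r := by
    by_contra! hlt
    nlinarith
  have hz0 : 0 < ‖z‖ := by
    rcases (norm_nonneg z).eq_or_lt with h0 | h0
    · rw [← h0] at hzr; norm_num at hzr
    · exact h0
  have habs : |l - (z⁻¹ + l).re| = ‖z⁻¹‖ := by
    have h1 : (((l - (z⁻¹ + l).re : ℝ)) : ℂ) = -z⁻¹ := by
      push_cast
      rw [← hre]; ring
    rw [← Real.norm_eq_abs, ← Complex.norm_real, h1, norm_neg]
  rw [habs, norm_inv, inv_le_iff_one_le_mul₀ hz0]
  linarith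

/-- The total mass of a convolution over `ℤ`, with summability of each fibre. -/
theorem hasSum_tsum_sub_mul {F g : ℤ → ℝ} {A B : ℝ} (hF : ∀ m, 0 ≤ F m) (hg : ∀ n, 0 ≤ g n)
    (hFA : HasSum F A) (hgB : HasSum g B) :
    (∀ j, Summable fun n => F (n - j) * g n) ∧
      HasSum (fun j => ∑' n, F (n - j) * g n) (A * B) := by
  have hs := hFA.summable.mul_of_nonneg hgB.summable hF hg
  have hAB : HasSum (fun p : ℤ × ℤ => F p.1 * g p.2) (A * B) := hFA.mul hgB hs
  let e : ℤ × ℤ ≃ ℤ × ℤ :=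
    { toFun := fun p => (p.2 - p.1, p.2)
      invFun := fun p => (p.2 - p.1, p.2)
      left_inv := fun p => by simp
      right_inv := fun p => by simp }
  have h2 : HasSum (fun p : ℤ × ℤ => F (p.2 - p.1) * g p.2) (A * B) := e.hasSum_iff.mpr hAB
  have h3 : ∀ j, Summable fun n => F (n - j) * g n := fun j => h2.summable.prod_factor j
  exact ⟨h3, h2.prod_fiberwise fun j => (h3 j).hasSum⟩

theorem lp_two_hasSum_norm_sq (f : lp (fun _ : ℤ => ℂ) 2) :
    HasSum (fun n => ‖f n‖ ^ 2) (‖f‖ ^ 2) := by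
  simpa using lp.hasSum_norm (p := 2) (by norm_num) f

/-- A bounded Jacobi operator on `ℓ²(ℤ)` with real diagonal is self-adjoint. -/
theorem isSelfAdjoint_of_jacobi {T : lp (fun _ : ℤ => ℂ) 2 →L[ℂ] lp (fun _ : ℤ => ℂ) 2}
    {a : ℤ → ℂ} {b : ℤ → ℝ} {M : ℝ} (ha : ∀ n, ‖a n‖ ≤ M)
    (hT : ∀ u n, (T u) n =
      a n * u (n + 1) + (starRingEnd ℂ) (a (n - 1)) * u (n - 1) + (b n : ℂ) * u n) :
    IsSelfAdjoint T := by
  rw [ContinuousLinearMap.isSelfAdjoint_iff_isSymmetric]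
  intro u w
  change inner ℂ (T u) w = inner ℂ u (T w)
  have hM : 0 ≤ M := (norm_nonneg _).trans (ha 0)
  have key : ∀ (x y : lp (fun _ : ℤ => ℂ) 2),
      Summable fun n => a n * ((starRingEnd ℂ) (x n) * y (n + 1)) := fun x y => by
    have hx := (lp_two_hasSum_norm_sq x).summable
    have hy := (Equiv.addRight (1 : ℤ)).summable_iff.mpr (lp_two_hasSum_norm_sq y).summable
    refine Summable.of_norm_bounded ((hx.add hy).mul_left M) fun n => ?_
    rw [norm_mul, norm_mul, RCLike.norm_conj]
    simp only [Function.comp_apply, Equiv.coe_addRight]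
    have := two_mul_le_add_sq ‖x n‖ ‖y (n + 1)‖
    have h0 : 0 ≤ ‖x n‖ * ‖y (n + 1)‖ := by positivity
    exact mul_le_mul (ha n) (by linarith) h0 hM
  have hB := (key u w).hasSum
  have hA : HasSum (fun n => (starRingEnd ℂ) (a n * ((starRingEnd ℂ) (w n) * u (n + 1))))
      ((starRingEnd ℂ) (∑' n, a n * ((starRingEnd ℂ) (w n) * u (n + 1)))) :=
    Complex.hasSum_conj'.mpr (by simpa using (key w u).hasSum)
  have hB' := (Equiv.subRight (1 : ℤ)).hasSum_iff.mpr hB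
  have hA' := (Equiv.subRight (1 : ℤ)).hasSum_iff.mpr hA
  have h1 := ((lp.hasSum_inner (𝕜 := ℂ) (T u) w).sub hA).sub hB'
  have h2 := ((lp.hasSum_inner (𝕜 := ℂ) u (T w)).sub hA').sub hB
  have h3 := h1.unique (h2.congr_fun ?_)
  · linear_combination h3
  · intro n
    simp only [RCLike.inner_apply, hT, Function.comp_apply, Equiv.subRight_apply, map_add, map_mul,
      Complex.conj_conj, Complex.conj_ofReal, sub_add_cancel]
    ring

/-- A `C¹` periodic function on the line is bounded and Lipschitz. -/
theorem exists_bound_lipschitz_of_periodic {E : Type*} [NormedAddCommGroup E] [NormedSpace ℝ E]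
    {f : ℝ → E} (hf : ContDiff ℝ 1 f) (hper : Function.Periodic f 1) :
    ∃ K : ℝ, 0 ≤ K ∧ (∀ x, ‖f x‖ ≤ K) ∧ ∀ x y, ‖f x - f y‖ ≤ K * |x - y| := by
  have hd : Function.Periodic (deriv f) 1 := fun x => by
    rw [← deriv_comp_add_const]
    exact congrArg (fun g => deriv g x) (funext hper)
  obtain ⟨A, hA⟩ := (hper.isBounded_of_continuous one_ne_zero hf.continuous).exists_norm_le
  obtain ⟨B, hB⟩ := (hd.isBounded_of_continuous one_ne_zero
    (hf.continuous_deriv le_rfl)).exists_norm_le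
  have hA' : ∀ x, ‖f x‖ ≤ A := fun x => hA _ ⟨x, rfl⟩
  have hB' : ∀ x, ‖deriv f x‖ ≤ B := fun x => hB _ ⟨x, rfl⟩
  refine ⟨max A B, ((norm_nonneg _).trans (hA' 0)).trans (le_max_left _ _),
    fun x => (hA' x).trans (le_max_left _ _), fun x y => ?_⟩
  rw [← Real.norm_eq_abs]
  exact Convex.norm_image_sub_le_of_norm_deriv_le (s := Set.univ)
    (fun z _ => (hf.differentiable one_ne_zero) z)
    (fun z _ => (hB' z).trans (le_max_right _ _)) convex_univ (Set.mem_univ y) (Set.mem_univ x)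

/-- The tent function of height and half-width `L` on `ℤ`. -/
def tent (L : ℕ) (m : ℤ) : ℝ := ((L - m.natAbs : ℕ) : ℝ)

theorem tent_nonneg (L : ℕ) (m : ℤ) : 0 ≤ tent L m := Nat.cast_nonneg _

theorem tent_le (L : ℕ) (m : ℤ) : tent L m ≤ L := Nat.cast_le.mpr (Nat.sub_le _ _)

theorem tent_eq_zero {L : ℕ} {m : ℤ} (h : L ≤ m.natAbs) : tent L m = 0 := by
  simp [tent, Nat.sub_eq_zero_of_le h]

theorem abs_tent_sub_le (L : ℕ) {m k : ℤ} (h : |m - k| ≤ 1) : |tent L m - tent L k| ≤ 1 := by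
  have h1 : (L - m.natAbs : ℕ) ≤ (L - k.natAbs : ℕ) + 1 := by grind
  have h2 : (L - k.natAbs : ℕ) ≤ (L - m.natAbs : ℕ) + 1 := by grind
  have h1' : tent L m ≤ tent L k + 1 := by unfold tent; exact_mod_cast h1
  have h2' : tent L k ≤ tent L m + 1 := by unfold tent; exact_mod_cast h2
  rw [abs_le]; constructor <;> linarith

theorem abs_mul_tent_le (L : ℕ) {m k : ℤ} (h : |k| ≤ |m| + 1) :
    |(k : ℝ)| * tent L m ≤ (L : ℝ) ^ 2 := by
  by_cases hm : L ≤ m.natAbs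
  · rw [tent_eq_zero hm, mul_zero]; positivity
  · have hk : |k| ≤ (L : ℤ) := by grind
    have hk' : |(k : ℝ)| ≤ L := by exact_mod_cast hk
    rw [sq]
    exact mul_le_mul hk' (tent_le L m) (tent_nonneg L m) (Nat.cast_nonneg L)

theorem hasSum_tent_sq (L : ℕ) :
    HasSum (fun m => tent L m ^ 2) (∑ m ∈ Finset.Icc (-(L : ℤ)) L, tent L m ^ 2) := by
  refine hasSum_sum_of_ne_finset_zero fun m hm => ?_
  rw [tent_eq_zero (by simp only [Finset.mem_Icc] at hm; omega)]
  norm_num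

theorem cube_le_sum_tent_sq (L : ℕ) :
    (L : ℝ) ^ 3 ≤ 3 * ∑ m ∈ Finset.Icc (-(L : ℤ)) L, tent L m ^ 2 := by
  have h1 : ∀ N : ℕ, N ^ 3 ≤ 3 * ∑ k ∈ Finset.range N, (N - k) ^ 2 := by
    intro N
    induction N with
    | zero => simp
    | succ N ih =>
      rw [Finset.sum_range_succ']
      simp only [Nat.add_sub_add_right, Nat.sub_zero]
      have h : (N + 1) ^ 3 ≤ N ^ 3 + 3 * (N + 1) ^ 2 := by ring_nf; omega
      rw [mul_add]
      exact h.trans (Nat.add_le_add_right ih _)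
  have h2 : ∑ k ∈ Finset.range L, ((L - k : ℕ) : ℝ) ^ 2 ≤
      ∑ m ∈ Finset.Icc (-(L : ℤ)) L, tent L m ^ 2 := by
    have h3 : ∑ k ∈ Finset.range L, ((L - k : ℕ) : ℝ) ^ 2 =
        ∑ m ∈ (Finset.range L).map Nat.castEmbedding, tent L m ^ 2 := by
      simp [tent]
    rw [h3]
    refine Finset.sum_le_sum_of_subset_of_nonneg (fun m hm => ?_) fun _ _ _ => by positivity
    simp only [Finset.mem_map, Finset.mem_range, Nat.castEmbedding_apply] at hm
    obtain ⟨k, hk, rfl⟩ := hm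
    simp only [Finset.mem_Icc]; omega
  have h4 : (L : ℝ) ^ 3 ≤ 3 * ∑ k ∈ Finset.range L, ((L - k : ℕ) : ℝ) ^ 2 := by
    exact_mod_cast h1 L
  linarith

/-- The indicator of the window `[-L, L]`. -/
noncomputable def window (L : ℕ) (m : ℤ) : ℝ := if m ∈ Finset.Icc (-(L : ℤ)) L then 1 else 0

theorem window_nonneg (L : ℕ) (m : ℤ) : 0 ≤ window L m := by
  unfold window; split_ifs <;> norm_num

theorem hasSum_window (L : ℕ) : HasSum (window L) (2 * L + 1) := by
  have h : HasSum (window L) (∑ m ∈ Finset.Icc (-(L : ℤ)) L, window L m) :=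
    hasSum_sum_of_ne_finset_zero fun m hm => by simp only [window, if_neg hm]
  have h2 : ∑ m ∈ Finset.Icc (-(L : ℤ)) L, window L m = 2 * L + 1 := by
    rw [Finset.sum_congr rfl (g := fun _ => (1 : ℝ)) fun m hm => by simp only [window, if_pos hm]]
    simp only [Finset.sum_const, Int.card_Icc, nsmul_eq_mul, mul_one]
    have : ((L : ℤ) + 1 - -(L : ℤ)).toNat = 2 * L + 1 := by omega
    rw [this]; push_cast; ring
  rwa [h2] at h

/-- Perturbing a coefficient and its cutoff factor simultaneously, inside a window. -/
theorem norm_mul_sub_mul_le_window {L : ℕ} {m p k : ℤ} {z z' : ℂ} {M D : ℝ} (hM : 0 ≤ M)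
    (hD : 0 ≤ D) (hp : |p - m| ≤ 1) (hk : |k| ≤ |p| + 1) (hz : ‖z‖ ≤ M)
    (hzz : ‖z' - z‖ ≤ D * |(k : ℝ)|) :
    ‖z' * tent L p - z * tent L m‖ ≤ (M + D * (L : ℝ) ^ 2) * window L m := by
  unfold window
  split_ifs with hm
  · have h : z' * tent L p - z * tent L m =
        (z' - z) * tent L p + z * ((tent L p - tent L m : ℝ) : ℂ) := by push_cast; ring
    rw [h]
    refine (norm_add_le _ _).trans ?_
    rw [norm_mul, norm_mul, Complex.norm_real, Complex.norm_real, Real.norm_eq_abs,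
      Real.norm_eq_abs, abs_of_nonneg (tent_nonneg L p)]
    have h1 : ‖z' - z‖ * tent L p ≤ D * (L : ℝ) ^ 2 :=
      calc ‖z' - z‖ * tent L p ≤ D * |(k : ℝ)| * tent L p :=
            mul_le_mul_of_nonneg_right hzz (tent_nonneg L p)
        _ = D * (|(k : ℝ)| * tent L p) := by ring
        _ ≤ _ := mul_le_mul_of_nonneg_left (abs_mul_tent_le L hk) hD
    have h2 : ‖z‖ * |tent L p - tent L m| ≤ M * 1 :=
      mul_le_mul hz (abs_tent_sub_le L hp) (abs_nonneg _) hM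
    linarith
  · simp only [Finset.mem_Icc] at hm
    rw [tent_eq_zero (by grind : L ≤ p.natAbs), tent_eq_zero (by omega : L ≤ m.natAbs)]
    simp

theorem norm_sq_add_four_le (x y z w : ℂ) :
    ‖x + y + z + w‖ ^ 2 ≤ 4 * (‖x‖ ^ 2 + ‖y‖ ^ 2 + ‖z‖ ^ 2 + ‖w‖ ^ 2) := by
  have h : ‖x + y + z + w‖ ≤ ‖x‖ + ‖y‖ + ‖z‖ + ‖w‖ :=
    (norm_add_le _ _).trans (by gcongr; exact norm_add₃_le)
  calc ‖x + y + z + w‖ ^ 2 ≤ (‖x‖ + ‖y‖ + ‖z‖ + ‖w‖) ^ 2 := by gcongr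
    _ ≤ _ := by
      nlinarith [sq_nonneg (‖x‖ - ‖y‖), sq_nonneg (‖x‖ - ‖z‖), sq_nonneg (‖x‖ - ‖w‖),
        sq_nonneg (‖y‖ - ‖z‖), sq_nonneg (‖y‖ - ‖w‖), sq_nonneg (‖z‖ - ‖w‖)]

set_option maxHeartbeats 1000000 in
/-- Localization of an approximate eigenvector: if every `T' j` is a Jacobi operator whose
coefficients near the site `j` are close to those of `T`, then some tent cutoff of an approximate
eigenvector of `T` is an approximate eigenvector of some `T' j`. -/
theorem exists_localized_approx_eigenvector
    {T : lp (fun _ : ℤ => ℂ) 2 →L[ℂ] lp (fun _ : ℤ => ℂ) 2}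
    {T' : ℤ → lp (fun _ : ℤ => ℂ) 2 →L[ℂ] lp (fun _ : ℤ => ℂ) 2}
    {a : ℤ → ℂ} {b : ℤ → ℝ} {a' : ℤ → ℤ → ℂ} {b' : ℤ → ℤ → ℝ} {M D ε R l : ℝ} {L : ℕ}
    (hL : 1 ≤ L) (hM : 0 ≤ M) (hD : 0 ≤ D) (hR : 0 ≤ R)
    (hT : ∀ u n, (T u) n =
      a n * u (n + 1) + (starRingEnd ℂ) (a (n - 1)) * u (n - 1) + (b n : ℂ) * u n)
    (hT' : ∀ j u n, (T' j u) n =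
      a' j n * u (n + 1) + (starRingEnd ℂ) (a' j (n - 1)) * u (n - 1) + (b' j n : ℂ) * u n)
    (ha : ∀ n, ‖a n‖ ≤ M)
    (haa : ∀ j n, ‖a' j n - a n‖ ≤ D * |((n - j : ℤ) : ℝ)|)
    (hbb : ∀ j n, |b' j n - b n| ≤ D * |((n - j : ℤ) : ℝ)|)
    {u : lp (fun _ : ℤ => ℂ) 2} (hu : u ≠ 0) (hul : ‖T u - (l : ℂ) • u‖ ≤ ε * ‖u‖)
    (hRε : (4 * ε ^ 2 * L ^ 2 + 108 * (M + D * (L : ℝ) ^ 2) ^ 2) < R ^ 2 * L ^ 2) :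
    ∃ j, ∃ x : lp (fun _ : ℤ => ℂ) 2, x ≠ 0 ∧ ‖T' j x - (l : ℂ) • x‖ ≤ R * ‖x‖ := by
  set w := T u - (l : ℂ) • u with hw
  set B := M + D * (L : ℝ) ^ 2 with hB
  set S := ∑ m ∈ Finset.Icc (-(L : ℤ)) L, tent L m ^ 2 with hS
  have hB0 : 0 ≤ B := by positivity
  have hu2 := lp_two_hasSum_norm_sq u
  have hw2 := lp_two_hasSum_norm_sq w
  have hup : HasSum (fun n => ‖u (n + 1)‖ ^ 2) (‖u‖ ^ 2) :=
    (Equiv.addRight (1 : ℤ)).hasSum_iff.mpr hu2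
  have hum : HasSum (fun n => ‖u (n - 1)‖ ^ 2) (‖u‖ ^ 2) :=
    (Equiv.subRight (1 : ℤ)).hasSum_iff.mpr hu2
  have hg : HasSum (fun n => ‖u (n + 1)‖ ^ 2 + ‖u (n - 1)‖ ^ 2 + ‖u n‖ ^ 2)
      (‖u‖ ^ 2 + ‖u‖ ^ 2 + ‖u‖ ^ 2) := (hup.add hum).add hu2
  obtain ⟨hs1, hsum1⟩ := hasSum_tsum_sub_mul (fun m => sq_nonneg (tent L m))
    (fun n => by positivity) (hasSum_tent_sq L) hu2
  obtain ⟨hs2, hsum2⟩ := hasSum_tsum_sub_mul (fun m => sq_nonneg (tent L m))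
    (fun n => by positivity) (hasSum_tent_sq L) hw2
  obtain ⟨hs3, hsum3⟩ := hasSum_tsum_sub_mul (window_nonneg L)
    (fun n => by positivity) (hasSum_window L) hg
  let x : ℤ → lp (fun _ : ℤ => ℂ) 2 := fun j =>
    ⟨fun n => (tent L (n - j) : ℂ) * u n, memℓp_gen (by
      simpa [mul_pow] using hs1 j)⟩
  have hx : ∀ j n, x j n = (tent L (n - j) : ℂ) * u n := fun _ _ => rfl
  have hxn : ∀ j, ‖x j‖ ^ 2 = ∑' n, tent L (n - j) ^ 2 * ‖u n‖ ^ 2 := fun j => by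
    rw [← (lp_two_hasSum_norm_sq (x j)).tsum_eq]
    exact tsum_congr fun n => by simp [hx, mul_pow]
  have hpt : ∀ j n, ‖(T' j (x j) - (l : ℂ) • x j) n‖ ^ 2 ≤
      4 * (tent L (n - j) ^ 2 * ‖w n‖ ^ 2) + 4 * B ^ 2 *
        (window L (n - j) * (‖u (n + 1)‖ ^ 2 + ‖u (n - 1)‖ ^ 2 + ‖u n‖ ^ 2)) := by
    intro j n
    have hwn : w n = a n * u (n + 1) + (starRingEnd ℂ) (a (n - 1)) * u (n - 1)
        + (b n : ℂ) * u n - l * u n := by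
      rw [hw, ← hT]; rfl
    have hdec : (T' j (x j) - (l : ℂ) • x j) n = tent L (n - j) * w n
        + (a' j n * tent L (n - j + 1) - a n * tent L (n - j)) * u (n + 1)
        + ((starRingEnd ℂ) (a' j (n - 1)) * tent L (n - j - 1)
          - (starRingEnd ℂ) (a (n - 1)) * tent L (n - j)) * u (n - 1)
        + ((b' j n - b n : ℝ) * tent L (n - j) - (0 : ℂ) * tent L (n - j)) * u n := by
      have h0 : (T' j (x j) - (l : ℂ) • x j) n = T' j (x j) n - l * x j n := rfl
      rw [h0, hT', hx, hx, hx, hwn, show n + 1 - j = n - j + 1 by ring,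
        show n - 1 - j = n - j - 1 by ring]
      push_cast
      ring
    have e1 : ‖a' j n * tent L (n - j + 1) - a n * tent L (n - j)‖ ≤ B * window L (n - j) :=
      norm_mul_sub_mul_le_window (k := n - j) hM hD (by simp) (by grind) (ha n) (haa j n)
    have e2 : ‖(starRingEnd ℂ) (a' j (n - 1)) * tent L (n - j - 1)
          - (starRingEnd ℂ) (a (n - 1)) * tent L (n - j)‖ ≤ B * window L (n - j) :=
      norm_mul_sub_mul_le_window (k := n - 1 - j) hM hD (by simp) (by grind)
        (by rw [RCLike.norm_conj]; exact ha (n - 1))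
        (by rw [← map_sub, RCLike.norm_conj]; exact haa j (n - 1))
    have e3 : ‖((b' j n - b n : ℝ) : ℂ) * tent L (n - j) - (0 : ℂ) * tent L (n - j)‖ ≤
        B * window L (n - j) :=
      norm_mul_sub_mul_le_window (k := n - j) hM hD (by simp) (by simp) (by simpa using hM)
        (by rw [sub_zero, Complex.norm_real]; exact hbb j n)
    have hsq : ∀ {z y : ℂ}, ‖z‖ ≤ B * window L (n - j) →
        ‖z * y‖ ^ 2 ≤ B ^ 2 * (window L (n - j) * ‖y‖ ^ 2) := by
      intro z y hz
      have hw2 : window L (n - j) ^ 2 = window L (n - j) := by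
        unfold window; split_ifs <;> norm_num
      calc ‖z * y‖ ^ 2 = ‖z‖ ^ 2 * ‖y‖ ^ 2 := by rw [norm_mul, mul_pow]
        _ ≤ (B * window L (n - j)) ^ 2 * ‖y‖ ^ 2 := by gcongr
        _ = _ := by rw [mul_pow, hw2]; ring
    rw [hdec]
    refine (norm_sq_add_four_le _ _ _ _).trans ?_
    have f0 : ‖(tent L (n - j) : ℂ) * w n‖ ^ 2 = tent L (n - j) ^ 2 * ‖w n‖ ^ 2 := by
      simp [mul_pow]
    have f1 := hsq (y := u (n + 1)) e1
    have f2 := hsq (y := u (n - 1)) e2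
    have f3 := hsq (y := u n) e3
    rw [f0]
    linarith
  have hfib : ∀ j, ‖T' j (x j) - (l : ℂ) • x j‖ ^ 2 ≤
      4 * (∑' n, tent L (n - j) ^ 2 * ‖w n‖ ^ 2) + 4 * B ^ 2 *
        ∑' n, window L (n - j) * (‖u (n + 1)‖ ^ 2 + ‖u (n - 1)‖ ^ 2 + ‖u n‖ ^ 2) := fun j =>
    hasSum_le (hpt j) (lp_two_hasSum_norm_sq _)
      (((hs2 j).hasSum.mul_left 4).add ((hs3 j).hasSum.mul_left (4 * B ^ 2)))
  by_contra! hcon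
  have hlow : ∀ j, R ^ 2 * ∑' n, tent L (n - j) ^ 2 * ‖u n‖ ^ 2 ≤
      ‖T' j (x j) - (l : ℂ) • x j‖ ^ 2 := fun j => by
    rw [← hxn, ← mul_pow]
    by_cases h0 : x j = 0
    · simp [h0]
    · have := (hcon j (x j) h0).le
      gcongr
  have hfin := hasSum_le (fun j => (hlow j).trans (hfib j)) (hsum1.mul_left (R ^ 2))
    ((hsum2.mul_left 4).add (hsum3.mul_left (4 * B ^ 2)))
  have hL1 : (1 : ℝ) ≤ L := by exact_mod_cast hL
  have hcube := cube_le_sum_tent_sq L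
  rw [← hS] at hcube hfin
  have hLS : (2 * (L : ℝ) + 1) * L ^ 2 ≤ 9 * S := by nlinarith [sq_nonneg (L : ℝ)]
  have hS0 : 0 < S := by
    have : 0 < (L : ℝ) ^ 3 := by positivity
    linarith
  have hU : 0 < ‖u‖ ^ 2 := by have := norm_pos_iff.mpr hu; positivity
  have hW : ‖w‖ ^ 2 ≤ ε ^ 2 * ‖u‖ ^ 2 := by
    rw [← mul_pow]; gcongr
  have hmain : R ^ 2 * L ^ 2 * (S * ‖u‖ ^ 2) ≤
      (4 * ε ^ 2 * L ^ 2 + 108 * B ^ 2) * (S * ‖u‖ ^ 2) :=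
    calc R ^ 2 * L ^ 2 * (S * ‖u‖ ^ 2) = (R ^ 2 * (S * ‖u‖ ^ 2)) * L ^ 2 := by ring
      _ ≤ (4 * (S * ‖w‖ ^ 2) + 4 * B ^ 2 *
          ((2 * L + 1) * (‖u‖ ^ 2 + ‖u‖ ^ 2 + ‖u‖ ^ 2))) * L ^ 2 := by gcongr
      _ = 4 * L ^ 2 * S * ‖w‖ ^ 2 + 12 * B ^ 2 * ‖u‖ ^ 2 * ((2 * L + 1) * L ^ 2) := by ring
      _ ≤ 4 * L ^ 2 * S * (ε ^ 2 * ‖u‖ ^ 2) + 12 * B ^ 2 * ‖u‖ ^ 2 * (9 * S) := by gcongr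
      _ = _ := by ring
  exact absurd (le_of_mul_le_mul_right hmain (by positivity)) (not_le.mpr hRε)


/-- ½-Hölder continuity of spectra of quasi-periodic Jacobi matrices: let `c`, `v` be `C¹`
and `1`-periodic (`v` real-valued), and for `α, θ ∈ ℝ` let `H α θ` be the Jacobi operator
`(H_{α,θ} u)_n = c(θ+nα) u_{n+1} + conj (c(θ+(n-1)α)) u_{n-1} + v(θ+nα) u_n` on `ℓ²(ℤ)`,
with `Σ_α = ⋃_θ σ(H_{α,θ})`. Then there are constants `C̃, C > 0` such that whenever
`λ ∈ Σ_α` and `|α - α'| < C̃`, there exists `λ' ∈ Σ_{α'}` with `|λ - λ'| ≤ C √|α - α'|`. -/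
theorem stmt_10 (c : ℝ → ℂ) (v : ℝ → ℝ)
    (hc : ContDiff ℝ 1 c) (hv : ContDiff ℝ 1 v)
    (hcper : ∀ x, c (x + 1) = c x) (hvper : ∀ x, v (x + 1) = v x)
    (H : ℝ → ℝ → (lp (fun _ : ℤ => ℂ) 2 →L[ℂ] lp (fun _ : ℤ => ℂ) 2))
    (hH : ∀ (α θ : ℝ) (u : lp (fun _ : ℤ => ℂ) 2) (n : ℤ),
      (H α θ u) n =
        c (θ + n * α) * u (n + 1)
        + (starRingEnd ℂ) (c (θ + (n - 1) * α)) * u (n - 1)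
        + (v (θ + n * α) : ℂ) * u n) :
    ∃ Ct : ℝ, 0 < Ct ∧ ∃ C : ℝ, 0 < C ∧
      ∀ (α α' lam : ℝ), (∃ θ : ℝ, (lam : ℂ) ∈ spectrum ℂ (H α θ)) →
        |α - α'| < Ct →
        ∃ lam' : ℝ, (∃ θ : ℝ, (lam' : ℂ) ∈ spectrum ℂ (H α' θ)) ∧
          |lam - lam'| ≤ C * Real.sqrt |α - α'| := by
  obtain ⟨Kc, hKc, hcM, hcL⟩ := exists_bound_lipschitz_of_periodic hc hcper
  obtain ⟨Kv, hKv, -, hvL⟩ := exists_bound_lipschitz_of_periodic hv hvper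
  have hT : ∀ α θ (u : lp (fun _ : ℤ => ℂ) 2) (n : ℤ), (H α θ u) n =
      c (θ + n * α) * u (n + 1)
        + (starRingEnd ℂ) (c (θ + (n - 1 : ℤ) * α)) * u (n - 1)
        + (v (θ + n * α) : ℂ) * u n := fun α θ u n => by
    push_cast
    exact hH α θ u n
  have hsa : ∀ α θ, IsSelfAdjoint (H α θ) := fun α θ =>
    isSelfAdjoint_of_jacobi (a := fun n : ℤ => c (θ + n * α)) (b := fun n : ℤ => v (θ + n * α))
      (fun n => hcM _) (hT α θ)
  set K := Kc + Kv with hK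
  have hK0 : 0 ≤ K := by positivity
  set C := 11 * (5 * K + 1) with hC
  have hC0 : 0 < C := by positivity
  refine ⟨1, one_pos, C, hC0, ?_⟩
  rintro α α' l ⟨θ, hl⟩ hδ1
  rcases eq_or_ne α α' with rfl | hne
  · exact ⟨l, ⟨θ, hl⟩, by simp⟩
  set δ := |α - α'| with hδ
  have hδ0 : 0 < δ := abs_pos.mpr (sub_ne_zero.mpr hne)
  set s := √δ with hs
  have hs0 : 0 < s := Real.sqrt_pos.mpr hδ0
  have hss : s ^ 2 = δ := Real.sq_sqrt hδ0.le
  have hs1 : s < 1 := by nlinarith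
  set L := ⌈s⁻¹⌉₊ with hLdef
  have hL1 : 1 ≤ L := Nat.one_le_ceil_iff.mpr (inv_pos.mpr hs0)
  have hLlow : 1 ≤ s * L := by
    have h1 : s⁻¹ ≤ L := Nat.le_ceil _
    calc 1 = s * s⁻¹ := (mul_inv_cancel₀ hs0.ne').symm
      _ ≤ s * L := by gcongr
  have hLup : s * L ≤ 2 := by
    have h1 : (L : ℝ) < s⁻¹ + 1 := Nat.ceil_lt_add_one (inv_pos.mpr hs0).le
    have h2 : s * L ≤ s * (s⁻¹ + 1) := by gcongr
    rw [mul_add, mul_inv_cancel₀ hs0.ne'] at h2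
    linarith
  have hδL : δ * (L : ℝ) ^ 2 ≤ 4 := by
    rw [← hss, ← mul_pow]
    nlinarith
  obtain ⟨u, hu, hul⟩ := exists_norm_apply_sub_smul_le (hsa α θ) hl hs0
  have hshift : ∀ j n : ℤ,
      |(θ + j * (α - α') + n * α') - (θ + n * α)| = δ * |((n - j : ℤ) : ℝ)| := fun j n => by
    rw [hδ, ← abs_mul, ← abs_neg]
    congr 1
    push_cast
    ring
  obtain ⟨j, x, hx, hxl⟩ := exists_localized_approx_eigenvector
    (T' := fun j => H α' (θ + j * (α - α'))) (a := fun n : ℤ => c (θ + n * α))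
    (b := fun n : ℤ => v (θ + n * α)) (a' := fun j n : ℤ => c (θ + j * (α - α') + n * α'))
    (b' := fun j n : ℤ => v (θ + j * (α - α') + n * α')) (M := K) (D := K * δ) (R := C * s)
    hL1 hK0 (by positivity) (by positivity) (hT α θ) (fun j => hT α' _)
    (fun n => (hcM _).trans (by linarith))
    (fun j n => (hcL _ _).trans (by
      rw [hshift, mul_assoc]
      exact mul_le_mul_of_nonneg_right (by linarith) (by positivity)))
    (fun j n => (hvL _ _).trans (by
      rw [hshift, mul_assoc]
      exact mul_le_mul_of_nonneg_right (by linarith) (by positivity)))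
    hu hul (by
      have hB : K + K * δ * (L : ℝ) ^ 2 ≤ 5 * K := by nlinarith
      have hB2 : (K + K * δ * (L : ℝ) ^ 2) ^ 2 ≤ (5 * K) ^ 2 := by gcongr
      have hsL : 1 ≤ s ^ 2 * (L : ℝ) ^ 2 := by rw [← mul_pow]; exact one_le_pow₀ hLlow
      have h1 : 108 * (5 * K) ^ 2 + 4 < C ^ 2 := by rw [hC]; nlinarith
      have h2 : (108 * (5 * K) ^ 2 + 4) * (s ^ 2 * (L : ℝ) ^ 2) < C ^ 2 * (s ^ 2 * (L : ℝ) ^ 2) :=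
        mul_lt_mul_of_pos_right h1 (by linarith)
      have h3 : 108 * (5 * K) ^ 2 * 1 ≤ 108 * (5 * K) ^ 2 * (s ^ 2 * (L : ℝ) ^ 2) := by gcongr
      rw [mul_pow C s]
      linarith)
  obtain ⟨l', hl', hll⟩ := exists_mem_spectrum_abs_sub_le (hsa α' _) (by positivity) hx hxl
  exact ⟨l', ⟨_, hl'⟩, hll⟩
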